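/- arXiv:2112.11621 — 2 statements merged into one kernel-verified Lean document; each statement's English description precedes it below -/
import Mathlib

section
/- Let f(y₁, y₂) = ind(y₂ − y₁²) and let (P₁f)(y₂) = ∫_ℝ f(y₁, y₂) ρ(y₁) dy₁. Then (P₁f)(y₂)/√y₂ → 2ρ(0) = √(2/π) as y₂ → 0⁺. Consequently P₁f has a square-root singularity at y₂ = 0: it is continuous there but its right-hand difference quotient (P₁f)(y₂)/y₂ tends to +∞ as y₂ → 0⁺, so P₁f is not differentiable at 0. -/
open Filter Topology Set

/-- The standard normal density. -/
noncomputable def ρ (y : ℝ) : ℝ := Real.exp (-y ^ 2 / 2) / Real.sqrt (2 * Real.pi)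

/-- The indicator `ind u = 1` if `u > 0` and `0` otherwise. -/
noncomputable def ind (u : ℝ) : ℝ := if 0 < u then 1 else 0

theorem rho_cont : Continuous ρ := by
  unfold ρ
  fun_prop

theorem P_eq (y : ℝ) : (∫ x : ℝ, ind (y - x ^ 2) * ρ x)
    = (∫ x in (0:ℝ)..(Real.sqrt y), ρ x) - ∫ x in (0:ℝ)..(-Real.sqrt y), ρ x := by
  rw [intervalIntegral.integral_interval_sub_left (rho_cont.intervalIntegrable _ _)
    (rho_cont.intervalIntegrable _ _)]
  have hs := Real.sqrt_nonneg y
  rw [intervalIntegral.integral_of_le (by linarith), MeasureTheory.integral_Ioc_eq_integral_Ioo,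
    ← MeasureTheory.integral_indicator measurableSet_Ioo]
  congr 1
  ext x
  have h : 0 < y - x ^ 2 ↔ x ∈ Ioo (-Real.sqrt y) (Real.sqrt y) := by
    rw [sub_pos, mem_Ioo, ← abs_lt, ← Real.sqrt_sq_eq_abs, Real.sqrt_lt_sqrt_iff (sq_nonneg x)]
  by_cases hx : 0 < y - x ^ 2
  · rw [indicator_of_mem (h.1 hx)]; simp [ind, hx]
  · rw [indicator_of_notMem (fun h' => hx (h.2 h'))]; simp [ind, hx]

theorem G_deriv : HasDerivAt (fun t : ℝ => (∫ x in (0:ℝ)..t, ρ x) - ∫ x in (0:ℝ)..(-t), ρ x)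
    (2 * ρ 0) 0 := by
  have h1 : ∀ t : ℝ, HasDerivAt (fun t : ℝ => ∫ x in (0:ℝ)..t, ρ x) (ρ t) t := fun t =>
    intervalIntegral.integral_hasDerivAt_right (rho_cont.intervalIntegrable _ _)
      rho_cont.stronglyMeasurable.stronglyMeasurableAtFilter rho_cont.continuousAt
  have h2 := (h1 (-0)).comp (0:ℝ) (hasDerivAt_neg (0:ℝ))
  have h3 := (h1 0).sub h2
  refine HasDerivAt.congr_deriv (f := fun t : ℝ => (∫ x in (0:ℝ)..t, ρ x) - ∫ x in (0:ℝ)..(-t), ρ x) h3 ?_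
  rw [neg_zero]; ring

theorem rho_zero : 2 * ρ 0 = Real.sqrt (2 / Real.pi) := by
  have hp := Real.pi_pos
  symm
  rw [Real.sqrt_eq_iff_mul_self_eq (by positivity) (by unfold ρ; positivity)]
  have h := Real.mul_self_sqrt (show 0 ≤ 2 * Real.pi by positivity)
  have h0 : Real.sqrt (2 * Real.pi) ≠ 0 := by positivity
  have : ρ 0 * Real.sqrt (2 * Real.pi) = 1 := by
    unfold ρ; simp; field_simp
  have h5 : ρ 0 * ρ 0 * (2 * Real.pi) = 1 := by
    rw [← h]; linear_combination (ρ 0 * Real.sqrt (2 * Real.pi) + 1) * this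
  field_simp
  linear_combination -h5

/-- **Example 1 of the paper: square-root singularity.**  For `f(y₁,y₂) = ind(y₂ − y₁²)` and
`(P₁ f)(y₂) = ∫_ℝ f(y₁,y₂) ρ(y₁) dy₁`, one has `(P₁ f)(y₂)/√y₂ → 2ρ(0) = √(2/π)` as
`y₂ → 0⁺`.  Consequently `P₁ f` is continuous at `0`, its right-hand difference quotient
`(P₁ f)(y₂)/y₂` tends to `+∞` as `y₂ → 0⁺`, and `P₁ f` is not differentiable at `0`. -/
theorem preintegration_parabola_sqrt_singularity :
    Tendsto (fun y₂ : ℝ => (∫ y₁ : ℝ, ind (y₂ - y₁ ^ 2) * ρ y₁) / Real.sqrt y₂)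
      (𝓝[>] 0) (𝓝 (2 * ρ 0)) ∧
    2 * ρ 0 = Real.sqrt (2 / Real.pi) ∧
    ContinuousAt (fun y₂ : ℝ => ∫ y₁ : ℝ, ind (y₂ - y₁ ^ 2) * ρ y₁) 0 ∧
    Tendsto (fun y₂ : ℝ => (∫ y₁ : ℝ, ind (y₂ - y₁ ^ 2) * ρ y₁) / y₂) (𝓝[>] 0) atTop ∧
    ¬ DifferentiableAt ℝ (fun y₂ : ℝ => ∫ y₁ : ℝ, ind (y₂ - y₁ ^ 2) * ρ y₁) 0 := by
  simp only [P_eq]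
  have hsq : Tendsto Real.sqrt (𝓝[>] 0) (𝓝[>] 0) := by
    refine tendsto_nhdsWithin_iff.2 ⟨?_, ?_⟩
    · have := (Real.continuous_sqrt.tendsto 0).mono_left (nhdsWithin_le_nhds (s := Ioi 0))
      simpa using this
    · filter_upwards [self_mem_nhdsWithin] with y hy using Real.sqrt_pos.2 hy
  have h1 : Tendsto (fun y : ℝ => ((∫ x in (0:ℝ)..(Real.sqrt y), ρ x)
      - ∫ x in (0:ℝ)..(-Real.sqrt y), ρ x) / Real.sqrt y) (𝓝[>] 0) (𝓝 (2 * ρ 0)) := by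
    have h := (G_deriv.tendsto_slope_zero_right).comp hsq
    refine h.congr fun y => ?_
    simp [div_eq_inv_mul]
  have hpos : 0 < 2 * ρ 0 := by unfold ρ; positivity
  have h4 : Tendsto (fun y : ℝ => ((∫ x in (0:ℝ)..(Real.sqrt y), ρ x)
      - ∫ x in (0:ℝ)..(-Real.sqrt y), ρ x) / y) (𝓝[>] 0) atTop := by
    have h := h1.pos_mul_atTop hpos (tendsto_inv_nhdsGT_zero.comp hsq)
    refine h.congr' ?_
    filter_upwards [self_mem_nhdsWithin] with y hy
    have hy' : 0 ≤ y := le_of_lt hy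
    simp only [Function.comp]
    rw [← div_eq_mul_inv, div_div, Real.mul_self_sqrt hy']
  refine ⟨h1, rho_zero, ?_, h4, ?_⟩
  · have hc := G_deriv.continuousAt
    exact ContinuousAt.comp_of_eq (f := Real.sqrt) hc Real.continuous_sqrt.continuousAt Real.sqrt_zero
  · intro hd
    have h := hd.hasDerivAt.tendsto_slope_zero_right
    refine not_tendsto_nhds_of_tendsto_atTop h4 _ (h.congr fun y => ?_)
    simp [div_eq_inv_mul]
end

section
/- Let h : ℝ → ℝ be continuous and strictly convex with h(y) → +∞ as y → ±∞, attaining its global minimum at y*, and let K ∈ ℝ. If h(y*) ≥ K then ∫_ℝ ind(h(y) − K) ρ(y) dy = 1 when h(y*) > K, and also equals 1 when h(y*) = K (the indicator fails only on a set of measure zero). If h(y*) < K, and ξ_a < ξ_b are the unique two solutions of h(y) = K, then ∫_ℝ ind(h(y) − K) ρ(y) dy = Φ(ξ_a) + 1 − Φ(ξ_b). -/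
open Filter Topology Set

/-- The standard normal cumulative distribution function. -/
noncomputable def Φ (x : ℝ) : ℝ := ∫ y in Set.Iic x, ρ y

theorem rho_eq : ρ = ProbabilityTheory.gaussianPDFReal 0 1 := by
  funext y
  simp only [ρ, ProbabilityTheory.gaussianPDFReal]
  simp
  ring

theorem rho_int : MeasureTheory.Integrable ρ := by
  rw [rho_eq]; exact ProbabilityTheory.integrable_gaussianPDFReal 0 1

theorem rho_one : ∫ y, ρ y = 1 := by
  rw [rho_eq]; exact ProbabilityTheory.integral_gaussianPDFReal_eq_one 0 (by norm_num)

/-- **Preintegration formula for the digital Asian option integrand.**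
Let `h : ℝ → ℝ` be continuous, strictly convex and coercive, attaining its global minimum
at `y*`, and let `K ∈ ℝ`.  If `h(y*) > K` then `∫_ℝ ind(h(y) − K) ρ(y) dy = 1`; if
`h(y*) = K` the integral also equals `1` (the indicator fails only on a measure-zero set);
and if `h(y*) < K` and `ξ_a < ξ_b` are the two solutions of `h(y) = K`, then
`∫_ℝ ind(h(y) − K) ρ(y) dy = Φ(ξ_a) + 1 − Φ(ξ_b)`. -/
theorem preintegration_strictConvex_formula
    (h : ℝ → ℝ) (hc : Continuous h) (hconv : StrictConvexOn ℝ Set.univ h)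
    (htop : Tendsto h atTop atTop) (hbot : Tendsto h atBot atTop)
    (ystar : ℝ) (hmin : ∀ y, h ystar ≤ h y) (K : ℝ) :
    (K < h ystar → (∫ y : ℝ, ind (h y - K) * ρ y) = 1) ∧
    (h ystar = K → (∫ y : ℝ, ind (h y - K) * ρ y) = 1) ∧
    (∀ ξa ξb : ℝ, h ystar < K → ξa < ξb → h ξa = K → h ξb = K →
      (∫ y : ℝ, ind (h y - K) * ρ y) = Φ ξa + 1 - Φ ξb) := by
  have key : ∀ a b c : ℝ, a < b → b < c → h b < max (h a) (h c) := by
    intro a b c hab hbc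
    refine hconv.lt_on_openSegment (mem_univ a) (mem_univ c) (hab.trans hbc).ne ?_
    rw [openSegment_eq_Ioo (hab.trans hbc)]
    exact ⟨hab, hbc⟩
  refine ⟨?_, ?_, ?_⟩
  · intro hK
    rw [← rho_one]
    congr 1
    funext y
    have : 0 < h y - K := by linarith [hmin y]
    simp [ind, this]
  · intro hK
    rw [← rho_one]
    apply MeasureTheory.integral_congr_ae
    have hne : ∀ᵐ y : ℝ, y ≠ ystar := by
      simp [MeasureTheory.ae_iff]
    filter_upwards [hne] with y hy
    have : 0 < h y - K := by
      by_contra hcon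
      have hy0 : h y ≤ h ystar := by linarith
      rcases lt_or_gt_of_ne hy with hlt | hlt
      · have h1 := key y ((y + ystar) / 2) ystar (by linarith) (by linarith)
        rw [max_eq_right hy0] at h1
        linarith [hmin ((y + ystar) / 2)]
      · have h1 := key ystar ((y + ystar) / 2) y (by linarith) (by linarith)
        rw [max_eq_left hy0] at h1
        linarith [hmin ((y + ystar) / 2)]
    simp [ind, this]
  · intro a b _ hab ha hb
    have e : (fun y : ℝ => ind (h y - K) * ρ y) =
        fun y => (Iio a).indicator ρ y + (Ioi b).indicator ρ y := by
      funext y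
      rcases lt_or_ge y a with h1 | h1
      · have hp : 0 < h y - K := by
          by_contra hcon
          have := key y a b h1 hab
          rw [hb, ha, max_eq_right (by linarith)] at this
          exact lt_irrefl _ this
        have h2 : ¬ b < y := by linarith
        simp [ind, hp, h1, h2]
      · rcases lt_or_ge b y with h2 | h2
        · have hp : 0 < h y - K := by
            by_contra hcon
            have := key a b y hab h2
            rw [hb, ha, max_eq_left (by linarith)] at this
            exact lt_irrefl _ this
          simp [ind, hp, h1, h2]
        · have hp : ¬ 0 < h y - K := by
            rcases h1.eq_or_lt with rfl | h1'
            · simp [ha]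
            · rcases h2.eq_or_lt with rfl | h2'
              · simp [hb]
              · have := key a y b h1' h2'
                rw [ha, hb, max_self] at this
                linarith
          simp only [ind, if_neg hp]
          simp [h1, h2]
    rw [e, MeasureTheory.integral_add (rho_int.indicator measurableSet_Iio)
      (rho_int.indicator measurableSet_Ioi),
      MeasureTheory.integral_indicator measurableSet_Iio,
      MeasureTheory.integral_indicator measurableSet_Ioi,
      ← MeasureTheory.integral_Iic_eq_integral_Iio]
    have h3 := MeasureTheory.integral_add_compl (measurableSet_Iic (a := b)) rho_int
    rw [compl_Iic, rho_one] at h3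
    simp only [Φ]
    linarith
end
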